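/- Let n ≥ 1. Consider the set Hom(U(1), U(n)) of continuous group homomorphisms from the circle group U(1) to the unitary group U(n), equipped with the compact-open topology, and let ∼ denote the equivalence relation of conjugation: ρ₁ ∼ ρ₂ iff there exists U ∈ U(n) with ρ₂(z) = U ρ₁(z) U⁻¹ for all z ∈ U(1). Then the quotient space Hom(U(1), U(n))/∼ is discrete. -/

import Mathlib

/-- Conjugation relation on the space of continuous homomorphisms `U(1) → U(n)`
(with the compact-open topology): `ρ₁ ∼ ρ₂` iff `ρ₂ = U ρ₁ U⁻¹` for some `U ∈ U(n)`. -/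
def unitaryConjRel (n : ℕ)
    (ρ₁ ρ₂ : ContinuousMonoidHom Circle (Matrix.unitaryGroup (Fin n) ℂ)) : Prop :=
  ∃ U : Matrix.unitaryGroup (Fin n) ℂ, ∀ z : Circle, ρ₂ z = U * ρ₁ z * U⁻¹

/-- An invertible intertwiner of unitary families can be made unitary (polar decomposition). -/
theorem exists_unitary_intertwiner {A : Type*} [CStarAlgebra A] [PartialOrder A]
    [StarOrderedRing A] {ι : Type*} (f g : ι → A) (hf : ∀ w, f w ∈ unitary A)
    (hg : ∀ w, g w ∈ unitary A) (a : A) (ha : IsUnit a) (h : ∀ w, f w * a = a * g w) :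
    ∃ u ∈ unitary A, ∀ w, f w * u = u * g w := by
  have hstar : ∀ w, star a * f w = g w * star a := by
    intro w
    have h1 : star a * star (f w) = star (g w) * star a := by
      rw [← star_mul, ← star_mul, h w]
    calc star a * f w = (g w * star (g w)) * star a * f w := by
          rw [Unitary.mul_star_self_of_mem (hg w), one_mul]
      _ = g w * (star (g w) * star a) * f w := by simp only [mul_assoc]
      _ = g w * (star a * star (f w)) * f w := by rw [h1]
      _ = g w * star a * (star (f w) * f w) := by simp only [mul_assoc]
      _ = g w * star a := by rw [Unitary.star_mul_self_of_mem (hf w), mul_one]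
  have hpos : (0 : A) ≤ star a * a := star_mul_self_nonneg a
  have hcomm : ∀ w, Commute (star a * a) (g w) := by
    intro w
    show star a * a * g w = g w * (star a * a)
    rw [mul_assoc, ← h w, ← mul_assoc, hstar w, mul_assoc]
  have hu : IsUnit (CFC.sqrt (star a * a)) := by
    rw [CFC.isUnit_sqrt_iff _ hpos]
    exact ha.star.mul ha
  have hpc : ∀ w, Commute (CFC.sqrt (star a * a)) (g w) := by
    intro w
    rw [CFC.sqrt_eq_cfc]
    exact (hcomm w).cfc_nnreal _
  have hsq : CFC.sqrt (star a * a) * CFC.sqrt (star a * a) = star a * a :=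
    CFC.sqrt_mul_sqrt_self _ hpos
  have hsa : star (CFC.sqrt (star a * a)) = CFC.sqrt (star a * a) :=
    (CFC.sqrt_nonneg (star a * a)).isSelfAdjoint.star_eq
  obtain ⟨p, hp⟩ := hu
  rw [← hp] at hpc hsq hsa
  have hsi : star (↑p⁻¹ : A) = ↑p⁻¹ := by
    have h2 : star p = p := Units.ext hsa
    rw [← Units.coe_star, star_inv, h2]
  have hiso : star (a * ↑p⁻¹) * (a * (↑p⁻¹ : A)) = 1 := by
    rw [star_mul, hsi]
    calc (↑p⁻¹ : A) * star a * (a * ↑p⁻¹) = ↑p⁻¹ * (star a * a) * ↑p⁻¹ := by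
          simp only [mul_assoc]
      _ = 1 := by rw [← hsq]; simp
  have hun : IsUnit (a * (↑p⁻¹ : A)) := ha.mul (Units.isUnit _)
  refine ⟨a * ↑p⁻¹, ?_, ?_⟩
  · rw [Unitary.mem_iff]
    refine ⟨hiso, ?_⟩
    obtain ⟨v, hv⟩ := hun
    rw [← hv] at hiso ⊢
    rw [Units.eq_inv_of_mul_eq_one_right hiso]
    simp
  · intro w
    have : (↑p⁻¹ : A) * g w = g w * ↑p⁻¹ := ((hpc w).units_inv_left).eq
    rw [← mul_assoc, h w, mul_assoc, mul_assoc, this]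

open MeasureTheory in
/-- Uniformly close unitary representations of a compact group admit an invertible intertwiner. -/
theorem exists_isUnit_intertwiner {A : Type*} [CStarAlgebra A] {G : Type*} [Group G]
    [TopologicalSpace G] [IsTopologicalGroup G] [CompactSpace G] [MeasurableSpace G]
    [BorelSpace G] [SecondCountableTopology G]
    (f g : G →* A) (hfc : Continuous f) (hgc : Continuous g)
    (hg : ∀ w, g w ∈ unitary A) (c : ℝ) (hc : c < 1)
    (hd : ∀ w, ‖f w - g w‖ ≤ c) : ∃ a : A, IsUnit a ∧ ∀ w, f w * a = a * g w := by
  rcases subsingleton_or_nontrivial A with hA | hA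
  · exact ⟨0, by rw [Subsingleton.elim (0 : A) 1]; exact isUnit_one, fun w => Subsingleton.elim _ _⟩
  let K : TopologicalSpace.PositiveCompacts G := ⊤
  let μ : Measure G := Measure.haarMeasure K
  have : IsProbabilityMeasure μ := ⟨by
    have := Measure.haarMeasure_self (K₀ := K)
    simpa [K] using this⟩
  have hF : Continuous fun z : G => f z * g z⁻¹ := hfc.mul (hgc.comp continuous_inv)
  have hint : ∀ F : G → A, Continuous F → Integrable F μ := fun F hF =>
    hF.integrable_of_hasCompactSupport (HasCompactSupport.of_compactSpace F)
  have hinv : ∀ z, g z * g z⁻¹ = 1 := fun z => by rw [← map_mul]; simp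
  have hnorm : ∀ z, ‖g z‖ = 1 := fun z => CStarRing.norm_of_mem_unitary (hg z)
  refine ⟨∫ z, f z * g z⁻¹ ∂μ, ?_, ?_⟩
  · have h1 : ‖∫ z, (1 - f z * g z⁻¹) ∂μ‖ ≤ c := by
      have := norm_integral_le_of_norm_le_const (μ := μ) (f := fun z => 1 - f z * g z⁻¹) (C := c)
        (Filter.Eventually.of_forall fun z => by
          have : 1 - f z * g z⁻¹ = -((f z - g z) * g z⁻¹) := by
            rw [sub_mul, hinv]; abel
          rw [this, norm_neg]
          refine (norm_mul_le _ _).trans ?_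
          rw [hnorm, mul_one]
          exact hd z)
      simpa using this
    rw [integral_sub (hint _ continuous_const) (hint _ hF)] at h1
    simp only [integral_const, probReal_univ, one_smul] at h1
    have := (Units.oneSub _ (h1.trans_lt hc)).isUnit
    simpa using this
  · intro w
    have e1 : f w * ∫ z, f z * g z⁻¹ ∂μ = ∫ z, f w * (f z * g z⁻¹) ∂μ :=
      ((ContinuousLinearMap.mul ℝ A (f w)).integral_comp_comm (hint _ hF)).symm
    have e2 : (∫ z, f z * g z⁻¹ ∂μ) * g w = ∫ z, (f z * g z⁻¹) * g w ∂μ :=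
      (((ContinuousLinearMap.mul ℝ A).flip (g w)).integral_comp_comm (hint _ hF)).symm
    rw [e1, e2, ← integral_mul_left_eq_self (μ := μ) (fun z => (f z * g z⁻¹) * g w) w]
    congr 1
    ext z
    rw [map_mul, mul_inv_rev, map_mul]
    have : g w⁻¹ * g w = 1 := by rw [← map_mul]; simp
    simp only [mul_assoc, this, mul_one]

open scoped Matrix.Norms.L2Operator MatrixOrder in
/-- Uniformly close homomorphisms are conjugate. -/
theorem unitaryConjRel_of_close (n : ℕ)
    (ρ₁ ρ₂ : ContinuousMonoidHom Circle (Matrix.unitaryGroup (Fin n) ℂ)) (c : ℝ) (hc : c < 1)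
    (hd : ∀ z, ‖(ρ₂ z : Matrix (Fin n) (Fin n) ℂ) - ρ₁ z‖ ≤ c) : unitaryConjRel n ρ₁ ρ₂ := by
  borelize Circle
  let f : Circle →* Matrix (Fin n) (Fin n) ℂ := (Submonoid.subtype _).comp ρ₂.toMonoidHom
  let g : Circle →* Matrix (Fin n) (Fin n) ℂ := (Submonoid.subtype _).comp ρ₁.toMonoidHom
  have hfc : Continuous f := continuous_subtype_val.comp ρ₂.continuous_toFun
  have hgc : Continuous g := continuous_subtype_val.comp ρ₁.continuous_toFun
  obtain ⟨a, ha, h⟩ := exists_isUnit_intertwiner f g hfc hgc (fun w => (ρ₁ w).2) c hc hd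
  obtain ⟨u, hu, h⟩ := exists_unitary_intertwiner f g (fun w => (ρ₂ w).2) (fun w => (ρ₁ w).2) a ha h
  refine ⟨⟨u, hu⟩, fun z => ?_⟩
  rw [eq_mul_inv_iff_mul_eq]
  exact Subtype.ext (h z)

open scoped Matrix.Norms.L2Operator in
/-- Each homomorphism has a neighbourhood of conjugate homomorphisms. -/
theorem eventually_unitaryConjRel (n : ℕ)
    (ρ : ContinuousMonoidHom Circle (Matrix.unitaryGroup (Fin n) ℂ)) :
    ∀ᶠ ρ' in nhds ρ, unitaryConjRel n ρ ρ' := by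
  let ι : C(Matrix.unitaryGroup (Fin n) ℂ, Matrix (Fin n) (Fin n) ℂ) :=
    ⟨Subtype.val, continuous_subtype_val⟩
  let Φ : ContinuousMonoidHom Circle (Matrix.unitaryGroup (Fin n) ℂ) →
      C(Circle, Matrix (Fin n) (Fin n) ℂ) := fun σ => ι.comp σ.toContinuousMap
  have hΦ : Continuous Φ := (ContinuousMap.continuous_postcomp ι).comp
    (ContinuousMonoidHom.isInducing_toContinuousMap _ _).continuous
  have := hΦ.continuousAt.eventually (Metric.ball_mem_nhds (Φ ρ) (ε := 1 / 2) (by norm_num))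
  filter_upwards [this] with ρ' h
  refine unitaryConjRel_of_close n ρ ρ' (1 / 2) (by norm_num) fun z => ?_
  rw [← dist_eq_norm]
  exact (ContinuousMap.dist_apply_le_dist (f := Φ ρ') (g := Φ ρ) z).trans (le_of_lt h)

/-- **Yang–Mills connections on `S²` are isolated.** The quotient of the space
`Hom(U(1), U(n))` of continuous homomorphisms (compact-open topology) by the
conjugation relation is a discrete topological space. -/
theorem discrete_quotient_hom_circle_unitaryGroup (n : ℕ) (hn : 1 ≤ n) :
    DiscreteTopology (Quot (unitaryConjRel n)) := by
  rw [discreteTopology_iff_forall_isOpen]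
  intro s
  rw [← isQuotientMap_quot_mk.isOpen_preimage, isOpen_iff_mem_nhds]
  intro ρ hρ
  filter_upwards [eventually_unitaryConjRel n ρ] with ρ' h
  have : Quot.mk (unitaryConjRel n) ρ = Quot.mk _ ρ' := Quot.sound h
  simpa only [Set.mem_preimage, ← this] using hρ
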